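/- Let ρ : ℝ^d → ℝ be the standard bump mollifier, ρ(θ) = k·exp(−1/(1−|θ|²)) for |θ| < 1 and ρ(θ) = 0 for |θ| ≥ 1, where k > 0 is chosen so that ρ integrates to 1 over ℝ^d, and for ε > 0 set ρ_ε(θ) = ε^{−d} ρ(θ/ε). Then there exists a constant C, depending only on d, such that for every ε > 0, every θ ∈ ℝ^d, and every index i ∈ {1,…,d}, |∂_{θ_i} ρ_ε(θ)| ≤ C ε^{−1} ρ_{2ε}(θ). -/

import Mathlib

open MeasureTheory

/-- The standard bump mollifier `ρ(θ) = k · exp(−1/(1−|θ|²))` for `|θ| < 1`, `0` otherwise. -/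
noncomputable def stdMollifier (d : ℕ) (k : ℝ) (θ : EuclideanSpace ℝ (Fin d)) : ℝ :=
  if ‖θ‖ < 1 then k * Real.exp (-(1 / (1 - ‖θ‖ ^ 2))) else 0

/-- The rescaled mollifier `ρ_ε(θ) = ε^{−d} ρ(θ/ε)`. -/
noncomputable def stdMollifierScaled (d : ℕ) (k ε : ℝ) (θ : EuclideanSpace ℝ (Fin d)) : ℝ :=
  ε ^ (-(d : ℤ)) * stdMollifier d k (ε⁻¹ • θ)

/-- The partial derivative `∂_{θ_i} f` of a function on `ℝ^d`. -/
noncomputable def partialDeriv (d : ℕ) (i : Fin d)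
    (f : EuclideanSpace ℝ (Fin d) → ℝ) (θ : EuclideanSpace ℝ (Fin d)) : ℝ :=
  fderiv ℝ f θ (EuclideanSpace.single i 1)

theorem stdMollifier_eq_expNegInvGlue (d : ℕ) (k : ℝ) (θ : EuclideanSpace ℝ (Fin d)) :
    stdMollifier d k θ = k * expNegInvGlue (1 - ‖θ‖ ^ 2) := by
  have h : 1 - ‖θ‖ ^ 2 ≤ 0 ↔ ¬ ‖θ‖ < 1 := by
    rw [not_lt, sub_nonpos, one_le_sq_iff₀ (norm_nonneg θ)]
  by_cases hθ : ‖θ‖ < 1 <;> simp [stdMollifier, expNegInvGlue, h, hθ]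

theorem hasDerivAt_expNegInvGlue (s : ℝ) :
    HasDerivAt expNegInvGlue (s⁻¹ ^ 2 * expNegInvGlue s) s := by
  simpa using expNegInvGlue.hasDerivAt_polynomial_eval_inv_mul 1 s

theorem inv_sq_mul_expNegInvGlue_le_two (s : ℝ) : s⁻¹ ^ 2 * expNegInvGlue s ≤ 2 := by
  rcases le_or_gt s 0 with hs | hs
  · simp [expNegInvGlue.zero_of_nonpos hs]
  · rw [expNegInvGlue, if_neg hs.not_ge, Real.exp_neg, ← div_eq_mul_inv,
      div_le_iff₀ (Real.exp_pos _)]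
    linarith [Real.quadratic_le_exp_of_nonneg (inv_pos.2 hs).le, inv_pos.2 hs]

theorem partialDeriv_stdMollifierScaled (d : ℕ) (k ε : ℝ) (θ : EuclideanSpace ℝ (Fin d))
    (i : Fin d) :
    partialDeriv d i (stdMollifierScaled d k ε) θ =
      ε ^ (-(d : ℤ)) * (k * ((1 - ‖ε⁻¹ • θ‖ ^ 2)⁻¹ ^ 2 * expNegInvGlue (1 - ‖ε⁻¹ • θ‖ ^ 2) *
        -(2 * ε⁻¹ * (ε⁻¹ • θ) i))) := by
  have hscale : HasFDerivAt (fun η : EuclideanSpace ℝ (Fin d) => ε⁻¹ • η)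
      (ε⁻¹ • ContinuousLinearMap.id ℝ _) θ := (hasFDerivAt_id θ).const_smul ε⁻¹
  have h := ((((hasDerivAt_expNegInvGlue _).comp_hasFDerivAt θ
    (hscale.norm_sq.const_sub 1)).const_mul k).const_mul (ε ^ (-(d : ℤ))))
  have hf : stdMollifierScaled d k ε =
      fun η => ε ^ (-(d : ℤ)) * (k * (expNegInvGlue ∘ fun η => 1 - ‖ε⁻¹ • η‖ ^ 2) η) :=
    funext fun η => by simp [stdMollifierScaled, stdMollifier_eq_expNegInvGlue]
  rw [partialDeriv, hf, h.fderiv]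
  simp [EuclideanSpace.inner_single_right, -mul_eq_mul_left_iff]
  ring

theorem exp_neg_four_thirds_le_expNegInvGlue {s : ℝ} (hs : 3 / 4 ≤ s) :
    Real.exp (-(4 / 3)) ≤ expNegInvGlue s := by
  rw [expNegInvGlue, if_neg (by linarith), Real.exp_le_exp, neg_le_neg_iff]
  exact (inv_anti₀ (by norm_num) hs).trans_eq (by norm_num)

/-- There is `C = C(d)` such that `|∂_{θ_i} ρ_ε(θ)| ≤ C ε⁻¹ ρ_{2ε}(θ)` for all `ε > 0`,
`θ ∈ ℝ^d` and `i`. -/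
theorem mollifier_deriv_bound (d : ℕ) (hd : 0 < d) :
    ∃ C > 0, ∀ (k : ℝ), 0 < k →
      (∫ θ : EuclideanSpace ℝ (Fin d), stdMollifier d k θ) = 1 →
      ∀ ε > (0 : ℝ), ∀ θ : EuclideanSpace ℝ (Fin d), ∀ i : Fin d,
        |partialDeriv d i (stdMollifierScaled d k ε) θ|
          ≤ C * ε⁻¹ * stdMollifierScaled d k (2 * ε) θ := by
  refine ⟨4 * 2 ^ d * Real.exp (4 / 3), by positivity, fun k hk _ ε hε θ i => ?_⟩
  rw [partialDeriv_stdMollifierScaled, stdMollifierScaled, stdMollifier_eq_expNegInvGlue]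
  have hx : ‖(2 * ε)⁻¹ • θ‖ = ‖ε⁻¹ • θ‖ / 2 := by
    rw [mul_inv, mul_smul, norm_smul]
    norm_num
    ring
  rw [hx]
  have hi := PiLp.norm_apply_le (ε⁻¹ • θ) i
  generalize ε⁻¹ • θ = x at hi ⊢
  rcases le_or_gt 1 ‖x‖ with h1 | h1
  · rw [expNegInvGlue.zero_of_nonpos (x := 1 - ‖x‖ ^ 2) (by nlinarith)]
    have := expNegInvGlue.nonneg (1 - (‖x‖ / 2) ^ 2)
    simp only [mul_zero, zero_mul, abs_zero]
    positivity
  · have hg := inv_sq_mul_expNegInvGlue_le_two (1 - ‖x‖ ^ 2)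
    have hg0 : 0 ≤ (1 - ‖x‖ ^ 2)⁻¹ ^ 2 * expNegInvGlue (1 - ‖x‖ ^ 2) :=
      mul_nonneg (sq_nonneg _) (expNegInvGlue.nonneg _)
    have hl := exp_neg_four_thirds_le_expNegInvGlue (s := 1 - (‖x‖ / 2) ^ 2)
      (by nlinarith [norm_nonneg x])
    have hxi : |x i| ≤ 1 := hi.trans h1.le
    have hC : 1 ≤ Real.exp (4 / 3) * expNegInvGlue (1 - (‖x‖ / 2) ^ 2) := by
      calc (1 : ℝ) = Real.exp (4 / 3) * Real.exp (-(4 / 3)) := by rw [← Real.exp_add]; simp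
        _ ≤ _ := by gcongr
    have hpow : (2 * ε) ^ (-(d : ℤ)) = (2 ^ d)⁻¹ * ε ^ (-(d : ℤ)) := by
      rw [mul_zpow, zpow_neg, zpow_natCast]
    generalize (1 - ‖x‖ ^ 2)⁻¹ ^ 2 * expNegInvGlue (1 - ‖x‖ ^ 2) = G at hg hg0 ⊢
    rw [abs_mul, abs_mul, abs_mul, abs_neg, abs_mul, abs_of_nonneg hg0, abs_of_pos hk,
      abs_of_pos (zpow_pos hε _), abs_of_pos (by positivity : 0 < 2 * ε⁻¹), hpow]
    calc _ ≤ ε ^ (-(d : ℤ)) * (k * (2 * (2 * ε⁻¹ * 1))) := by gcongr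
      _ = 4 * ε⁻¹ * ε ^ (-(d : ℤ)) * k * 1 := by ring
      _ ≤ 4 * ε⁻¹ * ε ^ (-(d : ℤ)) * k *
          (Real.exp (4 / 3) * expNegInvGlue (1 - (‖x‖ / 2) ^ 2)) := by gcongr
      _ = _ := by field_simp
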